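/- Let ξ be a root of f(X) = X^6 - 3X^5 + 5X^4 - 5X^3 + 5X^2 - 3X + 1. Then the field ℚ(ξ) is a totally complex Galois number field of degree 6 over ℚ. -/

import Mathlib

open Polynomial IntermediateField

/-- The polynomial `X^6 - 3X^5 + 5X^4 - 5X^3 + 5X^2 - 3X + 1`. -/
noncomputable def fpoly : Polynomial ℚ :=
  X ^ 6 - 3 * X ^ 5 + 5 * X ^ 4 - 5 * X ^ 3 + 5 * X ^ 2 - 3 * X + 1

theorem hroot_aux {K : Type*} [Field K] [Algebra ℚ K] (g : K) (hg : aeval g fpoly = 0) :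
    g ^ 6 - 3 * g ^ 5 + 5 * g ^ 4 - 5 * g ^ 3 + 5 * g ^ 2 - 3 * g + 1 = 0 := by
  simpa [fpoly, map_ofNat] using hg

theorem splits_lin {K : Type*} [Field K] (a b : K) : (C a * X + C b : K[X]).Splits :=
  Polynomial.Splits.of_natDegree_le_one (natDegree_linear_le)

theorem fpoly_splits {K : Type*} [Field K] [Algebra ℚ K] (g : K) (hg : aeval g fpoly = 0) :
    (fpoly.map (algebraMap ℚ K)).Splits := by
  have h := hroot_aux g hg
  have hg0 : g ≠ 0 := by
    rintro rfl
    norm_num at h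
  have hg1 : g - 1 ≠ 0 := by
    intro h1
    have : g = 1 := by linear_combination h1
    subst this
    norm_num at h
  have hC : (C g : K[X]) ^ 6 - 3 * C g ^ 5 + 5 * C g ^ 4 - 5 * C g ^ 3 + 5 * C g ^ 2
      - 3 * C g + 1 = 0 := by
    have := congrArg (C : K → K[X]) h
    simpa only [map_sub, map_add, map_mul, map_pow, map_ofNat, map_one, map_zero] using this
  have key : C (g ^ 2 * (g - 1) ^ 2) * fpoly.map (algebraMap ℚ K) =
      - ((C 1 * X + C (-g)) * (C g * X + C (-1)) * (C 1 * X + C (g - 1)) *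
      (C (1 - g) * X + C (-1)) * (C g * X + C (1 - g)) * (C (g - 1) * X + C (-g))) := by
    simp only [fpoly, Polynomial.map_add, Polynomial.map_sub, Polynomial.map_mul,
      Polynomial.map_pow, Polynomial.map_X, Polynomial.map_one, Polynomial.map_ofNat,
      map_sub, map_mul, map_pow, map_neg, map_one]
    linear_combination (X ^ 2 * (X - 1) ^ 2) * hC
  have hs : (C (g ^ 2 * (g - 1) ^ 2) * fpoly.map (algebraMap ℚ K)).Splits := by
    rw [key]
    exact (((((((splits_lin _ _).mul (splits_lin _ _)).mul (splits_lin _ _)).mul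
      (splits_lin _ _)).mul (splits_lin _ _)).mul (splits_lin _ _))).neg
  refine hs.of_dvd ?_ (dvd_mul_left _ _)
  refine mul_ne_zero ?_ ?_
  · exact C_ne_zero.2 (mul_ne_zero (pow_ne_zero _ hg0) (pow_ne_zero _ hg1))
  · refine (Polynomial.map_ne_zero_iff (algebraMap ℚ K).injective).2 ?_
    intro h0
    have := congrArg (eval 0) h0
    simp [fpoly] at this

theorem cubic_irr : Irreducible (X ^ 3 + 2 * X ^ 2 + 3 * X + 1 : ℚ[X]) := by
  have hd : (X ^ 3 + 2 * X ^ 2 + 3 * X + 1 : ℚ[X]).natDegree = 3 := by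
    compute_degree!
  rw [irreducible_iff_roots_eq_zero_of_degree_le_three (by omega) (by omega)]
  refine Multiset.eq_zero_of_forall_notMem fun r hr => ?_
  have hr' : r ^ 3 + 2 * r ^ 2 + 3 * r + 1 = 0 := by
    simpa using (mem_roots'.1 hr).2
  have hm : (X ^ 3 + 2 * X ^ 2 + 3 * X + 1 : ℤ[X]).Monic := by monicity!
  obtain ⟨n, hn⟩ := isInteger_of_is_root_of_monic (A := ℤ) (K := ℚ) hm (r := r)
    (by simpa [map_ofNat] using hr')
  have hn' : n ^ 3 + 2 * n ^ 2 + 3 * n + 1 = 0 := by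
    rw [← hn] at hr'
    simp only [algebraMap_int_eq, eq_intCast] at hr'
    exact_mod_cast hr'
  have hdv : n ∣ 1 := ⟨-(n ^ 2 + 2 * n + 3), by linear_combination hn'⟩
  rcases Int.isUnit_iff.1 (isUnit_of_dvd_one hdv) with rfl | rfl <;> norm_num at hn'

theorem stmt9 (ξ : ℂ) (hξ : Polynomial.aeval ξ fpoly = 0) :
    (∀ σ : ℚ⟮ξ⟯ →ₐ[ℚ] ℂ, ∃ x : ℚ⟮ξ⟯, (σ x).im ≠ 0) ∧
    Normal ℚ ℚ⟮ξ⟯ ∧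
    Module.finrank ℚ ℚ⟮ξ⟯ = 6 := by
  have hf6 : fpoly.natDegree = 6 := by
    unfold fpoly
    compute_degree!
  have hf0 : fpoly ≠ 0 := by
    intro h
    simp [h] at hf6
  have hint : IsIntegral ℚ ξ := isAlgebraic_iff_isIntegral.1 ⟨fpoly, hf0, hξ⟩
  have hfd : FiniteDimensional ℚ ℚ⟮ξ⟯ := adjoin.finiteDimensional hint
  have hg : aeval (AdjoinSimple.gen ℚ ξ) fpoly = 0 := by
    apply (algebraMap ℚ⟮ξ⟯ ℂ).injective
    rw [← aeval_algebraMap_apply, AdjoinSimple.algebraMap_gen, hξ, map_zero]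
  refine ⟨fun σ => ⟨AdjoinSimple.gen ℚ ξ, fun him => ?_⟩, ?_, ?_⟩
  · have h1 : aeval (σ (AdjoinSimple.gen ℚ ξ)) fpoly = 0 := by
      rw [aeval_algHom_apply, hg, map_zero]
    have h2 := hroot_aux _ h1
    set z := σ (AdjoinSimple.gen ℚ ξ)
    have hz : z = (z.re : ℂ) := Complex.ext (by simp) (by simp [him])
    rw [hz] at h2
    generalize z.re = t at h2
    have h3 : t ^ 6 - 3 * t ^ 5 + 5 * t ^ 4 - 5 * t ^ 3 + 5 * t ^ 2 - 3 * t + 1 = 0 := by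
      exact_mod_cast h2
    have hu : 0 ≤ t ^ 2 - t + 1 / 4 := by nlinarith [sq_nonneg (t - 1 / 2)]
    have h4 : (t ^ 2 - t) ^ 3 + 2 * (t ^ 2 - t) ^ 2 + 3 * (t ^ 2 - t) + 1 = 0 := by
      linear_combination h3
    generalize t ^ 2 - t = u at hu h4
    nlinarith [pow_nonneg hu 3, pow_nonneg hu 2]
  · rw [normal_iff]
    intro x
    refine ⟨IsIntegral.of_finite ℚ x, ?_⟩
    have := splits_of_mem_adjoin ℚ ℂ (L := ℚ⟮ξ⟯) (S := {ξ}) (x := (x : ℂ)) ?_ x.2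
    · rwa [← minpoly.algebraMap_eq (algebraMap ℚ⟮ξ⟯ ℂ).injective x]
    · rintro y rfl
      refine ⟨hint, (fpoly_splits _ hg).of_dvd ?_ ?_⟩
      · exact (Polynomial.map_ne_zero_iff (algebraMap ℚ _).injective).2 hf0
      · exact Polynomial.map_dvd _ (minpoly.dvd _ _ hξ)
  · have hle : Module.finrank ℚ ℚ⟮ξ⟯ ≤ 6 := by
      rw [adjoin.finrank hint, ← hf6]
      exact natDegree_le_of_dvd (minpoly.dvd _ _ hξ) hf0
    have hpos : 0 < Module.finrank ℚ ℚ⟮ξ⟯ := Module.finrank_pos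
    have h := hroot_aux _ hg
    generalize AdjoinSimple.gen ℚ ξ = g at h
    have h3 : 3 ∣ Module.finrank ℚ ℚ⟮ξ⟯ := by
      have hm : minpoly ℚ (g ^ 2 - g) = X ^ 3 + 2 * X ^ 2 + 3 * X + 1 := by
        refine (minpoly.eq_of_irreducible_of_monic cubic_irr ?_ (by monicity!)).symm
        simp only [map_add, map_mul, map_pow, map_ofNat, map_one, aeval_X]
        linear_combination h
      have := minpoly.degree_dvd (IsIntegral.of_finite ℚ (g ^ 2 - g))
      rw [hm] at this
      have hd : (X ^ 3 + 2 * X ^ 2 + 3 * X + 1 : ℚ[X]).natDegree = 3 := by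
        compute_degree!
      rwa [hd] at this
    have h2 : Even (Module.finrank ℚ ℚ⟮ξ⟯) := by
      by_contra hodd
      rw [Nat.not_even_iff_odd] at hodd
      have hd : (-7 + 18 * g - 14 * g ^ 2 + 16 * g ^ 3 - 10 * g ^ 4 + 4 * g ^ 5) ^ 2
          = algebraMap ℚ ℚ⟮ξ⟯ (-23) := by
        simp only [map_neg, map_ofNat]
        linear_combination (72 - 36 * g + 52 * g ^ 2 - 32 * g ^ 3 + 16 * g ^ 4) * h
      have hn := congrArg (Algebra.norm ℚ) hd
      rw [map_pow, Algebra.norm_algebraMap] at hn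
      have := hodd.pow_neg (show (-23 : ℚ) < 0 by norm_num)
      rw [← hn] at this
      exact absurd (sq_nonneg _) (not_le.2 this)
    obtain ⟨k, hk⟩ := h2
    omega
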